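/- Let G be a position containing a 4-loop, with c(G) ≥ −2. Then v(G) = |c(G)| unless G is the position consisting of two 3-chains and one 4-loop, in which case v(G) = 2. Moreover, opening a 4-loop is optimal unless G is the position consisting of three 3-chains and one 4-loop. -/

import Mathlib

namespace DotsAndBoxes

/-- A component of a Dots & Boxes endgame position: an `n`-chain or an `n`-loop. -/
inductive Component : Type where
  | chain (n : ℕ)
  | loop (n : ℕ)
deriving DecidableEq

namespace Component

/-- The number of boxes in a component. -/
def size : Component → ℕ
  | chain n => n
  | loop n => n

def isChain : Component → Bool
  | chain _ => true
  | loop _ => false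

def isLoop : Component → Bool
  | chain _ => false
  | loop _ => true

/-- A chain must have length at least 3; a loop must have even length at least 4. -/
def Valid : Component → Prop
  | chain n => 3 ≤ n
  | loop n => 4 ≤ n ∧ Even n

end Component

/-- A position is a finite multiset of components. -/
abbrev Position := Multiset Component

def Position.Valid (G : Position) : Prop := ∀ C ∈ G, C.Valid

/-- The number of unclaimed boxes in a position. -/
def size (G : Position) : ℕ := (G.map Component.size).sum

/-- The number of chains of a position. -/
def numChains (G : Position) : ℕ := Multiset.card (G.filter fun C => C.isChain = true)

/-- The number of loops of a position. -/
def numLoops (G : Position) : ℕ := Multiset.card (G.filter fun C => C.isLoop = true)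

/-- θ(G), the number of 3-chains. -/
def theta (G : Position) : ℕ := G.count (Component.chain 3)

/-- f(G), the number of 4-loops. -/
def numF (G : Position) : ℕ := G.count (Component.loop 4)

/-- s(G), the number of 6-loops. -/
def numS (G : Position) : ℕ := G.count (Component.loop 6)

open Classical in
/-- The terminal bonus tb(G). -/
noncomputable def tb (G : Position) : ℤ :=
  if G = 0 then 0
  else if ∀ C ∈ G, C.isLoop = true then 8
  else if (∃ C ∈ G, C.isLoop = true) ∧ Component.chain 3 ∈ G ∧
      (∀ C ∈ G, C.isChain = true → C = Component.chain 3) then 6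
  else 4

/-- The controlled value c(G). -/
noncomputable def cval (G : Position) : ℤ :=
  (size G : ℤ) - 4 * (numChains G : ℤ) - 8 * (numLoops G : ℤ) + tb G

/-- The score v(G;C) of opening component `C`, given that the remainder of the
position has value `w`. -/
def openVal (C : Component) (w : ℤ) : ℤ :=
  match C with
  | Component.chain n => ((n : ℤ) - 2) + |w - 2|
  | Component.loop n => ((n : ℤ) - 4) + |w - 4|

/-- Auxiliary recursion (on the number of components) for the value `v`. -/
noncomputable def valueAux : ℕ → Position → ℤ
  | 0, _ => 0
  | n + 1, G =>
    if G = 0 then 0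
    else sInf { x : ℤ | ∃ C ∈ G, x = openVal C (valueAux n (G.erase C)) }

/-- The value v(G): v(∅) = 0, and v(G) = min over components C of G of v(G;C). -/
noncomputable def value (G : Position) : ℤ := valueAux (Multiset.card G) G

/-- v(G;C), the value of G given that the opener has just opened C. -/
noncomputable def valueOpen (G : Position) (C : Component) : ℤ :=
  openVal C (value (G.erase C))

/-- Opening a component C of G is optimal if C ∈ G and v(G;C) = v(G). -/
def Optimal (G : Position) (C : Component) : Prop :=
  C ∈ G ∧ valueOpen G C = value G


open Component

theorem valueAux_congr (G : Position) (hG : G ≠ 0) :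
    value G = sInf { x : ℤ | ∃ C ∈ G, x = openVal C (value (G.erase C)) } := by
  obtain ⟨n, hn⟩ : ∃ n, Multiset.card G = n + 1 :=
    Nat.exists_eq_succ_of_ne_zero (by simpa using hG)
  unfold value
  rw [hn, valueAux, if_neg hG]
  congr 1
  ext x
  constructor
  · rintro ⟨C, hC, rfl⟩
    refine ⟨C, hC, ?_⟩
    rw [Multiset.card_erase_of_mem hC, hn]; rfl
  · rintro ⟨C, hC, rfl⟩
    refine ⟨C, hC, ?_⟩
    rw [Multiset.card_erase_of_mem hC, hn]; rfl

theorem value_zero : value 0 = 0 := by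
  simp [value, valueAux]

theorem moves_bdd (G : Position) :
    BddBelow { x : ℤ | ∃ C ∈ G, x = openVal C (value (G.erase C)) } := by
  apply Set.Finite.bddBelow
  apply Set.Finite.subset
    ((G.toFinset.finite_toSet).image (fun C => openVal C (value (G.erase C))))
  rintro x ⟨C, hC, rfl⟩
  exact ⟨C, by simpa using hC, rfl⟩

theorem value_le_cons (C : Component) (H : Position) :
    value (C ::ₘ H) ≤ openVal C (value H) := by
  rw [valueAux_congr _ (Multiset.cons_ne_zero)]
  apply csInf_le (moves_bdd _)
  exact ⟨C, by simp, by simp⟩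

theorem value_attained (G : Position) (hG : G ≠ 0) :
    ∃ C H, G = C ::ₘ H ∧ value G = openVal C (value H) := by
  have hne : { x : ℤ | ∃ C ∈ G, x = openVal C (value (G.erase C)) }.Nonempty := by
    obtain ⟨C, hC⟩ := Multiset.exists_mem_of_ne_zero hG
    exact ⟨_, C, hC, rfl⟩
  obtain ⟨C, hC, h⟩ := Int.csInf_mem hne (moves_bdd G)
  refine ⟨C, G.erase C, (Multiset.cons_erase hC).symm, ?_⟩
  rw [valueAux_congr G hG, h]

/-- controlled weight of a component -/
def wt : Component → ℤ
  | chain n => (n : ℤ) - 4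
  | loop n => (n : ℤ) - 8

/-- controlled value without terminal bonus -/
noncomputable def base (G : Position) : ℤ := (G.map wt).sum

theorem base_cons (C : Component) (H : Position) : base (C ::ₘ H) = wt C + base H := by
  simp [base]

theorem base_zero : base 0 = 0 := by simp [base]

theorem cval_eq (G : Position) : cval G = base G + tb G := by
  unfold cval
  congr 1
  induction G using Multiset.induction_on with
  | empty => simp [size, numChains, numLoops, base]
  | cons C H ih =>
    rw [base_cons, ← ih]
    cases C with
    | chain n =>
      have h1 : size (chain n ::ₘ H) = n + size H := by simp [size, Component.size]
      have h2 : numChains (chain n ::ₘ H) = numChains H + 1 := by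
        unfold numChains; rw [Multiset.filter_cons_of_pos _ (by simp [isChain, isLoop]), Multiset.card_cons]
      have h3 : numLoops (chain n ::ₘ H) = numLoops H := by
        unfold numLoops; rw [Multiset.filter_cons_of_neg _ (by simp [isLoop])]
      rw [h1, h2, h3]; simp only [wt]; push_cast; ring
    | loop n =>
      have h1 : size (loop n ::ₘ H) = n + size H := by simp [size, Component.size]
      have h2 : numLoops (loop n ::ₘ H) = numLoops H + 1 := by
        unfold numLoops; rw [Multiset.filter_cons_of_pos _ (by simp [isChain, isLoop]), Multiset.card_cons]
      have h3 : numChains (loop n ::ₘ H) = numChains H := by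
        unfold numChains; rw [Multiset.filter_cons_of_neg _ (by simp [isChain])]
      rw [h1, h2, h3]; simp only [wt]; push_cast; ring

def hasL (G : Position) : Prop := ∃ n, loop n ∈ G
def hasT (G : Position) : Prop := chain 3 ∈ G
def hasX (G : Position) : Prop := ∃ n, n ≠ 3 ∧ chain n ∈ G

theorem hasL_chain (n : ℕ) (H : Position) : hasL (chain n ::ₘ H) ↔ hasL H := by simp [hasL]
theorem hasL_loop (n : ℕ) (H : Position) : hasL (loop n ::ₘ H) ↔ True := by
  simp [hasL]
theorem hasT_chain (n : ℕ) (H : Position) : hasT (chain n ::ₘ H) ↔ (n = 3 ∨ hasT H) := by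
  simp [hasT, eq_comm]
theorem hasT_loop (n : ℕ) (H : Position) : hasT (loop n ::ₘ H) ↔ hasT H := by simp [hasT]
theorem hasX_chain (n : ℕ) (H : Position) : hasX (chain n ::ₘ H) ↔ (n ≠ 3 ∨ hasX H) := by
  simp only [hasX, Multiset.mem_cons, chain.injEq]
  constructor
  · rintro ⟨k, h, rfl | h2⟩
    · exact Or.inl h
    · exact Or.inr ⟨k, h, h2⟩
  · rintro (h | ⟨k, h, h2⟩)
    · exact ⟨n, h, Or.inl rfl⟩
    · exact ⟨k, h, Or.inr h2⟩
theorem hasX_loop (n : ℕ) (H : Position) : hasX (loop n ::ₘ H) ↔ hasX H := by simp [hasX]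

theorem zero_iff (G : Position) : G = 0 ↔ ¬ hasL G ∧ ¬ hasT G ∧ ¬ hasX G := by
  constructor
  · rintro rfl; simp [hasL, hasT, hasX]
  · rintro ⟨h1, h2, h3⟩
    apply Multiset.eq_zero_of_forall_notMem
    intro C hC
    cases C with
    | chain n =>
      by_cases h : n = 3
      · subst h; exact h2 hC
      · exact h3 ⟨n, h, hC⟩
    | loop n => exact h1 ⟨n, hC⟩

open Classical in
/-- terminal bonus in terms of the three flags -/
noncomputable def tbf (l t x : Prop) : ℤ :=
  if ¬ l ∧ ¬ t ∧ ¬ x then 0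
  else if ¬ t ∧ ¬ x then 8
  else if l ∧ t ∧ ¬ x then 6 else 4

open Classical in
theorem tb_eq (G : Position) : tb G = tbf (hasL G) (hasT G) (hasX G) := by
  have e1 : (∀ C ∈ G, C.isLoop = true) ↔ (¬ hasT G ∧ ¬ hasX G) := by
    constructor
    · intro h
      refine ⟨fun h2 => ?_, ?_⟩
      · simpa [isLoop] using h _ h2
      · rintro ⟨n, _, h2⟩
        simpa [isLoop] using h _ h2
    · rintro ⟨h2, h3⟩ C hC
      cases C with
      | chain n =>
        by_cases h : n = 3
        · subst h; exact absurd hC h2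
        · exact absurd ⟨n, h, hC⟩ h3
      | loop n => rfl
  have e2 : (∃ C ∈ G, C.isLoop = true) ↔ hasL G := by
    constructor
    · rintro ⟨C, hC, h⟩
      cases C with
      | chain n => simp [isLoop] at h
      | loop n => exact ⟨n, hC⟩
    · rintro ⟨n, h⟩; exact ⟨_, h, rfl⟩
  have e3 : (∀ C ∈ G, C.isChain = true → C = chain 3) ↔ ¬ hasX G := by
    constructor
    · rintro h ⟨n, hn, h2⟩
      have := h _ h2 rfl
      simp at this; exact hn this
    · intro h C hC h2
      cases C with
      | chain n =>
        by_contra h3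
        exact h ⟨n, by simpa using h3, hC⟩
      | loop n => simp [isChain] at h2
  have e4 : chain 3 ∈ G ↔ hasT G := Iff.rfl
  unfold tb tbf
  exact if_congr (zero_iff G) rfl (if_congr e1 rfl
    (if_congr (and_congr e2 (and_congr e4 e3)) rfl rfl))

theorem tb_even (G : Position) : ∃ k : ℤ, tb G = 2 * k := by
  rw [tb_eq, tbf]
  split_ifs
  exacts [⟨0, rfl⟩, ⟨4, rfl⟩, ⟨3, rfl⟩, ⟨2, rfl⟩]

theorem value_parity (G : Position) : ∃ k : ℤ, value G = base G + 2 * k := by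
  induction hn : Multiset.card G generalizing G with
  | zero =>
    have : G = 0 := by simpa using hn
    subst this
    exact ⟨0, by simp [value_zero, base_zero]⟩
  | succ n ih =>
    obtain ⟨C, H, rfl, h⟩ := value_attained G (by rintro rfl; simp at hn)
    obtain ⟨k, hk⟩ := ih H (by simpa using hn)
    rw [h, base_cons, hk]
    cases C with
    | chain m =>
      simp only [openVal, wt]
      rcases abs_cases (base H + 2 * k - 2) with ⟨e, _⟩ | ⟨e, _⟩ <;> rw [e]
      · exact ⟨k, by ring⟩
      · exact ⟨- base H - k + 2, by ring⟩
    | loop m =>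
      simp only [openVal, wt]
      rcases abs_cases (base H + 2 * k - 4) with ⟨e, _⟩ | ⟨e, _⟩ <;> rw [e]
      · exact ⟨k, by ring⟩
      · exact ⟨- base H - k + 4, by ring⟩

theorem value_nonneg (G : Position) (hG : G.Valid) : 0 ≤ value G := by
  by_cases h0 : G = 0
  · subst h0; simp [value_zero]
  obtain ⟨C, H, rfl, h⟩ := value_attained G h0
  have hv := hG C (by simp)
  rw [h]
  cases C with
  | chain m =>
    simp only [Component.Valid] at hv
    simp only [openVal]
    have := abs_nonneg (value H - 2)
    omega
  | loop m =>
    simp only [Component.Valid] at hv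
    simp only [openVal]
    have := abs_nonneg (value H - 4)
    omega

theorem valid_tail {C : Component} {H : Position} (h : Position.Valid (C ::ₘ H)) : H.Valid :=
  fun D hD => h D (by simp [hD])

theorem eq_replicate_of (H : Position) (h1 : ¬ hasL H) (h2 : ¬ hasX H) :
    H = Multiset.replicate (Multiset.card H) (chain 3) := by
  rw [Multiset.eq_replicate]
  refine ⟨rfl, fun C hC => ?_⟩
  cases C with
  | chain n =>
    by_contra h
    exact h2 ⟨n, by simpa using h, hC⟩
  | loop n => exact absurd ⟨n, hC⟩ h1

noncomputable def av (k : ℕ) : ℤ := value (Multiset.replicate k (chain 3))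
noncomputable def bv (k : ℕ) : ℤ := value (loop 4 ::ₘ Multiset.replicate k (chain 3))

theorem av_zero : av 0 = 0 := by simp [av, value_zero]

theorem av_succ (k : ℕ) : av (k + 1) = 1 + |av k - 2| := by
  obtain ⟨C, H, h1, h2⟩ := value_attained (Multiset.replicate (k + 1) (chain 3)) (by simp)
  have hC : C = chain 3 := Multiset.eq_of_mem_replicate (n := k + 1) (by rw [h1]; simp)
  subst hC
  rw [Multiset.replicate_succ, Multiset.cons_inj_right] at h1
  subst h1
  unfold av
  rw [h2]; simp [openVal]

theorem bv_zero : bv 0 = 4 := by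
  obtain ⟨C, H, h1, h2⟩ := value_attained (loop 4 ::ₘ Multiset.replicate 0 (chain 3)) (by simp)
  have hC : C = loop 4 := by
    have : C ∈ loop 4 ::ₘ Multiset.replicate 0 (chain 3) := by rw [h1]; simp
    simpa using this
  subst hC
  rw [Multiset.cons_inj_right] at h1
  subst h1
  unfold bv
  rw [h2]; simp [openVal, value_zero]

theorem bv_succ (k : ℕ) : bv (k + 1) = min |av (k + 1) - 4| (1 + |bv k - 2|) := by
  apply le_antisymm
  · apply le_min
    · refine (value_le_cons (loop 4) (Multiset.replicate (k + 1) (chain 3))).trans (le_of_eq ?_)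
      simp [openVal, av]
    · have := value_le_cons (chain 3) (loop 4 ::ₘ Multiset.replicate k (chain 3))
      rw [Multiset.cons_swap, ← Multiset.replicate_succ] at this
      refine this.trans (le_of_eq ?_)
      simp [openVal, bv]
  · obtain ⟨C, H, h1, h2⟩ :=
      value_attained (loop 4 ::ₘ Multiset.replicate (k + 1) (chain 3)) (by simp)
    have hC : C = loop 4 ∨ C = chain 3 := by
      have : C ∈ loop 4 ::ₘ Multiset.replicate (k + 1) (chain 3) := by rw [h1]; simp
      rcases Multiset.mem_cons.1 this with h | h
      · exact Or.inl h
      · exact Or.inr (Multiset.eq_of_mem_replicate h)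
    rcases hC with rfl | rfl
    · rw [Multiset.cons_inj_right] at h1
      subst h1
      apply min_le_of_left_le
      apply le_of_eq
      unfold bv av
      rw [h2]; simp [openVal]
    · rw [Multiset.replicate_succ, Multiset.cons_swap, Multiset.cons_inj_right] at h1
      subst h1
      apply min_le_of_right_le
      apply le_of_eq
      unfold bv
      rw [h2]; simp [openVal]

/-- The controlled value is a lower bound. -/
theorem cval_le_value (G : Position) (hG : G.Valid) : cval G ≤ value G := by
  induction hn : Multiset.card G generalizing G with
  | zero =>
    have : G = 0 := by simpa using hn
    subst this
    simp [value_zero, cval_eq, base_zero, tb]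
  | succ n ih =>
    obtain ⟨C, H, rfl, h⟩ := value_attained G (by rintro rfl; simp at hn)
    have hH := valid_tail hG
    have ihH := ih H hH (by simpa using hn)
    have hv := hG C (by simp)
    rw [h, cval_eq, base_cons]
    rw [cval_eq] at ihH
    by_cases h0 : H = 0
    · subst h0
      cases C with
      | chain m =>
        simp only [openVal, wt, value_zero, base_zero, tb_eq, hasL_chain, hasT_chain, hasX_chain]
        have := (zero_iff 0).1 rfl
        simp only [this, Component.Valid] at hv ⊢
        by_cases d : m = 3 <;> simp [d, tbf]
      | loop m =>
        simp only [openVal, wt, value_zero, base_zero, tb_eq, hasL_loop, hasT_loop, hasX_loop]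
        have := (zero_iff 0).1 rfl
        simp only [this, Component.Valid] at hv ⊢
        simp [tbf]
    have h0' := h0
    rw [zero_iff] at h0'
    cases C with
    | chain m =>
      have ht : tb (chain m ::ₘ H) ≤ tb H := by
        rw [tb_eq, tb_eq H]
        simp only [hasL_chain, hasT_chain, hasX_chain]
        by_cases a : hasL H <;> by_cases b : hasT H <;> by_cases c : hasX H <;>
          by_cases d : m = 3 <;> simp_all [tbf]
      have := le_abs_self (value H - 2)
      simp only [openVal, wt]
      omega
    | loop m =>
      by_cases hp : ¬ hasL H ∧ ¬ hasX H
      · have hr := eq_replicate_of H hp.1 hp.2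
        obtain ⟨k, hk⟩ : ∃ k, Multiset.card H = k := ⟨_, rfl⟩
        rw [hk] at hr
        have hT : hasT H := by tauto
        have ht : tb (loop m ::ₘ H) = 6 := by
          rw [tb_eq]
          simp only [hasL_loop, hasT_loop, hasX_loop]
          simp [hT, hp.2, tbf]
        have hb : base H = - k := by rw [hr]; simp [base, wt]
        have hva : value H = av k := by rw [hr]; rfl
        rw [ht, hb, hva]
        simp only [openVal, wt]
        have := abs_nonneg (av k - 4)
        by_cases k1 : k = 1
        · subst k1
          rw [av_succ, av_zero]; norm_num; omega
        · have : k ≠ 0 := by rintro rfl; simp at hr; exact h0 hr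
          omega
      · have ht : tb (loop m ::ₘ H) ≤ tb H := by
          rw [tb_eq, tb_eq H]
          simp only [hasL_loop, hasT_loop, hasX_loop]
          by_cases a : hasL H <;> by_cases b : hasT H <;> by_cases c : hasX H <;>
            simp_all [tbf]
        have := le_abs_self (value H - 4)
        simp only [openVal, wt]
        omega

theorem base_nonneg (G : Position) (h : ∀ C ∈ G, 0 ≤ wt C) : 0 ≤ base G := by
  unfold base
  apply Multiset.sum_nonneg
  intro x hx
  obtain ⟨C, hC, rfl⟩ := Multiset.mem_map.1 hx
  exact h C hC

/-- Inductive step for opening a loop. -/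
theorem step_loop (m : ℕ) (H : Position) (ht : tb (loop m ::ₘ H) = tb H)
    (hH : value H ≤ cval H) (h4 : cval (loop m ::ₘ H) ≥ m - 4) (hl : cval H ≤ value H) :
    value (loop m ::ₘ H) ≤ cval (loop m ::ₘ H) := by
  refine (value_le_cons _ _).trans ?_
  rw [cval_eq] at *
  rw [base_cons] at *
  simp only [openVal, wt] at *
  rw [abs_of_nonneg] <;> omega

theorem step_chain (m : ℕ) (H : Position) (ht : tb (chain m ::ₘ H) = tb H)
    (hH : value H ≤ cval H) (h4 : cval (chain m ::ₘ H) ≥ m - 2) (hl : cval H ≤ value H) :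
    value (chain m ::ₘ H) ≤ cval (chain m ::ₘ H) := by
  refine (value_le_cons _ _).trans ?_
  rw [cval_eq] at *
  rw [base_cons] at *
  simp only [openVal, wt] at *
  rw [abs_of_nonneg] <;> omega

theorem tb_nonneg (G : Position) : 0 ≤ tb G := by
  rw [tb_eq, tbf]; split_ifs <;> norm_num

theorem tb_ge (G : Position) (h : G ≠ 0) : 4 ≤ tb G := by
  rw [ne_eq, zero_iff] at h
  rw [tb_eq, tbf, if_neg h]; split_ifs <;> norm_num

/-- If the controlled value is at least two, it is the value. -/
theorem value_le_cval (G : Position) (hG : G.Valid) (hc : 2 ≤ cval G) : value G ≤ cval G := by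
  induction hn : Multiset.card G generalizing G with
  | zero =>
    have : G = 0 := by simpa using hn
    subst this
    simp [cval_eq, base_zero, tb] at hc
  | succ n ih =>
    -- generic loop step
    have key : ∀ m H, G = loop m ::ₘ H → tb G = tb H → cval G ≥ m - 4 →
        cval G ≥ m - 6 → value G ≤ cval G := by
      rintro m H rfl ht h4 _
      have hH := valid_tail hG
      refine step_loop m H ht (ih H hH ?_ (by simpa using hn)) h4 (cval_le_value H hH)
      rw [cval_eq, base_cons] at h4
      rw [cval_eq]; simp only [wt] at h4; omega
    have keyc : ∀ m H, G = chain m ::ₘ H → tb G = tb H → cval G ≥ m - 2 →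
        value G ≤ cval G := by
      rintro m H rfl ht h4
      have hH := valid_tail hG
      refine step_chain m H ht (ih H hH ?_ (by simpa using hn)) h4 (cval_le_value H hH)
      rw [cval_eq, base_cons] at h4
      rw [cval_eq]; simp only [wt] at h4; omega
    -- single components
    have single : ∀ C : Component, G = {C} → value G ≤ cval G := by
      rintro C rfl
      have hv := hG C (by simp)
      have h1 := value_le_cons C 0
      have hz := (zero_iff 0).1 rfl
      rw [← Multiset.cons_zero]
      refine h1.trans ?_
      rw [cval_eq, base_cons, base_zero, value_zero, tb_eq]
      cases C with
      | chain m =>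
        simp only [openVal, wt, hasL_chain, hasT_chain, hasX_chain, hz]
        by_cases d : m = 3 <;> simp [d, tbf]
      | loop m =>
        simp only [openVal, wt, hasL_loop, hasT_loop, hasX_loop, hz]
        simp [tbf]
    -- small loops / big components
    have big : ∀ C ∈ G, C.Valid → C ≠ chain 3 → C ≠ loop 4 → C ≠ loop 6 → 0 ≤ wt C := by
      intro C _ hv h1 h2 h3
      cases C with
      | chain m => simp [Component.Valid, wt] at *; omega
      | loop m =>
        simp only [Component.Valid, wt, ne_eq, loop.injEq] at *
        obtain ⟨h, r, hr⟩ := hv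
        omega
    by_cases hT3 : hasT G
    · obtain ⟨H, rfl⟩ := Multiset.exists_cons_of_mem hT3
      by_cases h0 : H = 0
      · subst h0; exact single _ rfl
      by_cases hHT : hasT H ∨ hasX H
      · apply keyc 3 H rfl _ (by norm_num; omega)
        rw [tb_eq, tb_eq H]
        simp only [hasL_chain, hasT_chain, hasX_chain]
        by_cases a : hasL H <;> by_cases b : hasT H <;> by_cases c : hasX H <;>
          simp_all [tbf]
      · -- one 3-chain and loops
        have h0' := h0
        rw [zero_iff] at h0'
        obtain ⟨hT, hX⟩ := not_or.1 hHT
        have htG : tb (chain 3 ::ₘ H) = 6 := by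
          rw [tb_eq]
          simp only [hasL_chain, hasT_chain, hasX_chain]
          simp_all [tbf]
        have go : ∀ m K, H = loop m ::ₘ K → K ≠ 0 → cval (chain 3 ::ₘ H) ≥ m - 4 →
            value (chain 3 ::ₘ H) ≤ cval (chain 3 ::ₘ H) := by
          intro m K hK hK0 h4
          apply key m (chain 3 ::ₘ K) (by rw [hK, Multiset.cons_swap]) _ h4 (by omega)
          rw [htG, tb_eq]
          subst hK
          rw [ne_eq, zero_iff] at hK0
          simp only [hasL_chain, hasT_chain, hasX_chain, hasT_loop, hasX_loop] at *
          simp_all [tbf]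
        have lone : ∀ m, H = {loop m} →
            value (chain 3 ::ₘ H) ≤ cval (chain 3 ::ₘ H) := by
          rintro m rfl
          have hv := hG (loop m) (by simp)
          have e : chain 3 ::ₘ {loop m} = loop m ::ₘ Multiset.replicate 1 (chain 3) := by
            rw [← Multiset.cons_zero, Multiset.cons_swap]; rfl
          have h1 := value_le_cons (loop m) (Multiset.replicate 1 (chain 3))
          have h2 := av_succ 0
          rw [av_zero] at h2
          unfold av at h2
          norm_num at h2
          rw [← e] at h1
          refine h1.trans ?_
          rw [cval_eq, htG]
          simp [openVal, h2, base, wt]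
          omega
        have go2 : ∀ m, loop m ∈ H → cval (chain 3 ::ₘ H) ≥ m - 4 →
            value (chain 3 ::ₘ H) ≤ cval (chain 3 ::ₘ H) := by
          intro m hm h4
          obtain ⟨K, hK⟩ := Multiset.exists_cons_of_mem hm
          by_cases hK0 : K = 0
          · subst hK0; exact lone m hK
          · exact go m K hK hK0 h4
        by_cases l4 : loop 4 ∈ H
        · exact go2 4 l4 (by norm_num; omega)
        by_cases l6 : loop 6 ∈ H
        · exact go2 6 l6 (by norm_num; omega)
        obtain ⟨m, hm⟩ : hasL H := by tauto
        obtain ⟨K, hK⟩ := Multiset.exists_cons_of_mem hm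
        have hb : 0 ≤ base K := by
          apply base_nonneg
          intro C hC
          have hCH : C ∈ H := by rw [hK]; simp [hC]
          apply big C (by simp [hCH]) (hG C (by simp [hCH]))
          · rintro rfl; exact hT hCH
          · rintro rfl; exact l4 hCH
          · rintro rfl; exact l6 hCH
        apply go2 m hm
        rw [cval_eq, htG, base_cons, hK, base_cons]
        simp only [wt]
        omega
    · -- no 3-chains
      have go2 : ∀ m, loop m ∈ G → cval G ≥ m - 4 → value G ≤ cval G := by
        intro m hm h4
        obtain ⟨K, hK⟩ := Multiset.exists_cons_of_mem hm
        by_cases hK0 : K = 0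
        · subst hK0; exact single _ hK
        · apply key m K hK _ h4 (by omega)
          subst hK
          rw [tb_eq, tb_eq K]
          rw [zero_iff] at hK0
          simp only [hasL_loop, hasT_loop, hasX_loop] at *
          by_cases a : hasL K <;> by_cases c : hasX K <;> simp_all [tbf]
      by_cases l4 : loop 4 ∈ G
      · exact go2 4 l4 (by norm_num; omega)
      by_cases l6 : loop 6 ∈ G
      · exact go2 6 l6 (by norm_num; omega)
      have hbig : ∀ C ∈ G, 0 ≤ wt C := by
        intro C hC
        apply big C hC (hG C hC)
        · rintro rfl; exact hT3 hC
        · rintro rfl; exact l4 hC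
        · rintro rfl; exact l6 hC
      have h0 : G ≠ 0 := by rintro rfl; simp at hn
      have htb := tb_ge G h0
      by_cases hL : hasL G
      · obtain ⟨m, hm⟩ := hL
        obtain ⟨K, hK⟩ := Multiset.exists_cons_of_mem hm
        have hb : 0 ≤ base K := base_nonneg K (fun C hC => hbig C (by rw [hK]; simp [hC]))
        apply go2 m hm
        have : base G = wt (loop m) + base K := by rw [hK, base_cons]
        rw [cval_eq, this]
        simp only [wt]
        omega
      · obtain ⟨m, hm3, hm⟩ : hasX G := by
          rw [ne_eq, zero_iff] at h0; tauto
        obtain ⟨K, hK⟩ := Multiset.exists_cons_of_mem hm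
        by_cases hK0 : K = 0
        · subst hK0; exact single _ hK
        have hb : 0 ≤ base K := base_nonneg K (fun C hC => hbig C (by rw [hK]; simp [hC]))
        apply keyc m K hK
        · subst hK
          rw [tb_eq, tb_eq K]
          rw [zero_iff] at hK0
          simp only [hasL_chain, hasT_chain, hasX_chain] at *
          simp_all [tbf]
        · have : base G = wt (chain m) + base K := by rw [hK, base_cons]
          rw [cval_eq, this]
          simp only [wt]
          omega

theorem value_eq_cval (G : Position) (hG : G.Valid) (hc : 2 ≤ cval G) : value G = cval G :=
  le_antisymm (value_le_cval G hG hc) (cval_le_value G hG)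

/-- First example of 4-loop optimality: if G has a 4-loop and c(G) ≥ −2 then
v(G) = |c(G)| unless G = 3+3+4ₗ (where v(G) = 2), and opening a 4-loop is optimal
unless G = 3+3+3+4ₗ. -/
theorem four_loop_optimality_one (G : Position) (hG : G.Valid)
    (h4 : Component.loop 4 ∈ G) (hc : -2 ≤ cval G) :
    (G ≠ Component.chain 3 ::ₘ Component.chain 3 ::ₘ {Component.loop 4} →
      value G = |cval G|) ∧
    (G = Component.chain 3 ::ₘ Component.chain 3 ::ₘ {Component.loop 4} →
      value G = 2) ∧
    (G ≠ Component.chain 3 ::ₘ Component.chain 3 ::ₘ Component.chain 3 ::ₘ {Component.loop 4} →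
      Optimal G (Component.loop 4)) := by
  obtain ⟨H, rfl⟩ := Multiset.exists_cons_of_mem h4
  have hH := valid_tail hG
  unfold Optimal valueOpen
  rw [Multiset.erase_cons_head]
  have e2 : (chain 3 ::ₘ chain 3 ::ₘ {loop 4} : Position) =
      loop 4 ::ₘ Multiset.replicate 2 (chain 3) := by
    rw [← Multiset.cons_zero, Multiset.cons_swap (chain 3) (loop 4),
      Multiset.cons_swap (chain 3) (loop 4)]; rfl
  have e3 : (chain 3 ::ₘ chain 3 ::ₘ chain 3 ::ₘ {loop 4} : Position) =
      loop 4 ::ₘ Multiset.replicate 3 (chain 3) := by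
    rw [e2, Multiset.cons_swap (chain 3) (loop 4)]; rfl
  rw [e3, e2]
  simp only [ne_eq, Multiset.cons_inj_right]
  by_cases hp : ¬ hasL H ∧ ¬ hasX H
  · have hr := eq_replicate_of H hp.1 hp.2
    obtain ⟨k, hk⟩ : ∃ k, Multiset.card H = k := ⟨_, rfl⟩
    rw [hk] at hr
    subst hr
    have hb : base (Multiset.replicate k (chain 3)) = - k := by simp [base, wt]
    have hcv : cval (loop 4 ::ₘ Multiset.replicate k (chain 3)) =
        if k = 0 then (4 : ℤ) else 2 - (k : ℤ) := by
      rw [cval_eq, base_cons, hb, tb_eq]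
      simp only [hasL_loop, hasT_loop, hasX_loop, hp.2, wt]
      by_cases hk0 : k = 0
      · subst hk0; simp [hasT, tbf]
      · have : hasT (Multiset.replicate k (chain 3)) := Multiset.mem_replicate.2 ⟨hk0, rfl⟩
        simp [this, hk0, tbf]; ring
    have hk4 : k ≤ 4 := by
      rw [hcv] at hc
      split_ifs at hc <;> omega
    rw [hcv]
    change (_ → bv k = _) ∧ (_ → bv k = 2) ∧ (_ → _ ∧ openVal (loop 4) (av k) = bv k)
    have a0 := av_zero
    have a1 : av 1 = 3 := by rw [av_succ, a0]; norm_num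
    have a2 : av 2 = 2 := by rw [av_succ, a1]; norm_num
    have a3 : av 3 = 1 := by rw [av_succ, a2]; norm_num
    have a4 : av 4 = 2 := by rw [av_succ, a3]; norm_num
    have b0 := bv_zero
    have b1 : bv 1 = 1 := by rw [bv_succ, b0, a1]; norm_num
    have b2 : bv 2 = 2 := by rw [bv_succ, b1, a2]; norm_num
    have b3 : bv 3 = 1 := by rw [bv_succ, b2, a3]; norm_num
    have b4 : bv 4 = 2 := by rw [bv_succ, b3, a4]; norm_num
    have inj : ∀ i j : ℕ, Multiset.replicate i (chain 3) = Multiset.replicate j (chain 3) ↔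
        i = j := by
      intro i j
      constructor
      · intro h; simpa using congrArg Multiset.card h
      · rintro rfl; rfl
    simp only [inj]
    interval_cases k <;> simp [openVal, *]
  · have n2 : ∀ j, H ≠ Multiset.replicate j (chain 3) := by
      rintro j rfl
      apply hp
      constructor
      · rintro ⟨n, h⟩
        simpa using Multiset.eq_of_mem_replicate h
      · rintro ⟨n, h3, h⟩
        exact h3 (by simpa using Multiset.eq_of_mem_replicate h)
    have ht : tb (loop 4 ::ₘ H) = tb H := by
      rw [tb_eq, tb_eq H]
      simp only [hasL_loop, hasT_loop, hasX_loop]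
      by_cases a : hasL H <;> by_cases b : hasT H <;> by_cases c : hasX H <;> simp_all [tbf]
    have hcc : cval (loop 4 ::ₘ H) = cval H - 4 := by
      rw [cval_eq, cval_eq, ht, base_cons]; simp only [wt]; push_cast; ring
    have hvH := value_eq_cval H hH (by omega)
    have hle : value (loop 4 ::ₘ H) ≤ |cval (loop 4 ::ₘ H)| := by
      have := value_le_cons (loop 4) H
      simpa [openVal, hvH, hcc] using this
    have hopen : openVal (loop 4) (value H) = |cval (loop 4 ::ₘ H)| := by
      simp [openVal, hvH, hcc]
    have hge : |cval (loop 4 ::ₘ H)| ≤ value (loop 4 ::ₘ H) := by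
      have hlow := cval_le_value _ hG
      have hnn := value_nonneg _ hG
      obtain ⟨p, hp1⟩ := value_parity (loop 4 ::ₘ H)
      obtain ⟨q, hq⟩ := tb_even (loop 4 ::ₘ H)
      have hce := cval_eq (loop 4 ::ₘ H)
      by_cases hm2 : cval (loop 4 ::ₘ H) = -2
      · have hne : value (loop 4 ::ₘ H) ≠ 0 := by
          intro hz
          obtain ⟨C, K, hK, hv⟩ := value_attained (loop 4 ::ₘ H) (by simp)
          have hCv := hG C (by rw [hK]; simp)
          rw [hz] at hv
          cases C with
          | chain m =>
            simp only [openVal, Component.Valid] at hv hCv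
            have := abs_nonneg (value K - 2)
            omega
          | loop m =>
            simp only [openVal, Component.Valid] at hv hCv
            have := abs_nonneg (value K - 4)
            have hm : m = 4 := by omega
            subst hm
            rw [Multiset.cons_inj_right] at hK
            subst hK
            rw [hvH] at hv
            have : cval H = 2 := by omega
            rw [this] at hv
            norm_num at hv
        rw [hm2]; norm_num; omega
      · rcases abs_cases (cval (loop 4 ::ₘ H)) with ⟨e, _⟩ | ⟨e, _⟩ <;> rw [e] <;> omega
    have heq := le_antisymm hle hge
    exact ⟨fun _ => heq, fun h => absurd h (n2 2), fun _ => ⟨h4, by rw [hopen, heq]⟩⟩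

end DotsAndBoxes
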